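/- Let n ≥ 2 and s ∈ (0,1). There exists ε₀ = ε₀(n,s) > 0 such that for every ε ∈ (0, ε₀) the variational problem min{ P_s(E) + ε V_s(E) : E ⊂ ℝⁿ measurable, |E| = ω_n } admits a solution, where ω_n = |B₁|. -/

import Mathlib

open MeasureTheory Metric Set Filter
open scoped ENNReal NNReal symmDiff Topology

noncomputable section

/-- The ambient Euclidean space `ℝⁿ`. -/
abbrev Rn (n : ℕ) := EuclideanSpace ℝ (Fin n)

/-- The fractional `s`-perimeter `P_s(E) = ∫_E ∫_{Eᶜ} |x-y|^{-(n+s)} dx dy`. -/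
def fracPer (n : ℕ) (s : ℝ) (E : Set (Rn n)) : ℝ≥0∞ :=
  ∫⁻ x in E, ∫⁻ y in Eᶜ, ENNReal.ofReal (‖x - y‖ ^ (-((n : ℝ) + s)))

/-- The Riesz-type potential `∫_E |x-y|^{-s} dx` of `E` evaluated at `y`. -/
def rieszAt (n : ℕ) (s : ℝ) (E : Set (Rn n)) (y : Rn n) : ℝ≥0∞ :=
  ∫⁻ x in E, ENNReal.ofReal (‖x - y‖ ^ (-s))

/-- `V_s(E) = max_{y ∈ ℝⁿ} ∫_E |x-y|^{-s} dx`. -/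
def Vs (n : ℕ) (s : ℝ) (E : Set (Rn n)) : ℝ≥0∞ := ⨆ y : Rn n, rieszAt n s E y

/-- `ω_n`, the volume of the unit ball of `ℝⁿ`. -/
def unitBallVol (n : ℕ) : ℝ := (volume (ball (0 : Rn n) 1)).toReal

/-- The radius `r` such that `|B_r| = |E|`. -/
def ballRad (n : ℕ) (E : Set (Rn n)) : ℝ :=
  ((volume E).toReal / unitBallVol n) ^ ((1 : ℝ) / n)

/-- The fractional isoperimetric deficit `δ_s(E) = (P_s(E) - P_s(B_r))/P_s(B_r)`,
where `|B_r| = |E|`. -/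
def fracDeficit (n : ℕ) (s : ℝ) (E : Set (Rn n)) : ℝ :=
  ((fracPer n s E).toReal - (fracPer n s (ball (0 : Rn n) (ballRad n E))).toReal) /
    (fracPer n s (ball (0 : Rn n) (ballRad n E))).toReal

/-- The normalization constant `c_{n,s} = P_s(B₁)(n-s)/(n ω_n)`. -/
def cns (n : ℕ) (s : ℝ) : ℝ :=
  (fracPer n s (ball (0 : Rn n) 1)).toReal * ((n : ℝ) - s) / (n * unitBallVol n)

/-- The strong asymmetry index
`A_s(E) = min_y { |E Δ B_r(y)|/|B_r| + ((P_s(E) - c_{n,s} ∫_E |x-y|^{-s} dx)/P_s(B_r))^{1/2} }`,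
with `|B_r| = |E|`. -/
def asymA (n : ℕ) (s : ℝ) (E : Set (Rn n)) : ℝ :=
  ⨅ y : Rn n,
    ((volume (E ∆ ball y (ballRad n E))).toReal /
        (volume (ball (0 : Rn n) (ballRad n E))).toReal +
      Real.sqrt (((fracPer n s E).toReal - cns n s * (rieszAt n s E y).toReal) /
        (fracPer n s (ball (0 : Rn n) (ballRad n E))).toReal))

/-- The oscillation index `β_s(E) = ((P_s(E) - c_{n,s} V_s(E))/P_s(B_r))^{1/2}`,
with `|B_r| = |E|`. -/
def betaS (n : ℕ) (s : ℝ) (E : Set (Rn n)) : ℝ :=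
  Real.sqrt (((fracPer n s E).toReal - cns n s * (Vs n s E).toReal) /
    (fracPer n s (ball (0 : Rn n) (ballRad n E))).toReal)

/-- The asymmetry index `ζ_s(E) = (V_s(B_r) - V_s(E))/V_s(B_r)`, with `|B_r| = |E|`. -/
def zetaS (n : ℕ) (s : ℝ) (E : Set (Rn n)) : ℝ :=
  ((Vs n s (ball (0 : Rn n) (ballRad n E))).toReal - (Vs n s E).toReal) /
    (Vs n s (ball (0 : Rn n) (ballRad n E))).toReal

/-- The Fraenkel asymmetry `α(E) = min_y |E Δ B_r(y)|/|B_r|`, with `|B_r| = |E|`. -/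
def fraenkel (n : ℕ) (E : Set (Rn n)) : ℝ :=
  ⨅ y : Rn n, (volume (E ∆ ball y (ballRad n E))).toReal /
    (volume (ball (0 : Rn n) (ballRad n E))).toReal

/-- The fractional Cheeger constant `h_{m,s}(Ω) = inf { P_s(E)/|E|^m : E ⊆ Ω }`. -/
def cheeger (n : ℕ) (m s : ℝ) (Ω : Set (Rn n)) : ℝ :=
  sInf {x : ℝ | ∃ E : Set (Rn n), E ⊆ Ω ∧ MeasurableSet E ∧ 0 < volume E ∧
    x = (fracPer n s E).toReal / (volume E).toReal ^ m}

/-- The energy functional `E_s(E) = P_s(E) + ε V_s(E)`. -/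
def energy (n : ℕ) (s ε : ℝ) (E : Set (Rn n)) : ℝ≥0∞ :=
  fracPer n s E + ENNReal.ofReal ε * Vs n s E

/-- The generalized energy functional `Ẽ_s({E^k}) = Σ_k E_s(E^k)`. -/
def genEnergy (n : ℕ) (s ε : ℝ) (F : ℕ → Set (Rn n)) : ℝ≥0∞ :=
  ∑' k : ℕ, energy n s ε (F k)

/-- Absolute difference in `ℝ≥0∞` (equal to `|a - b|` for finite values). -/
def ennAbsDiff (a b : ℝ≥0∞) : ℝ≥0∞ := (a - b) + (b - a)

/-- The penalized generalized functional `Ẽ_{s,Λ}({E^k}) = Ẽ_s({E^k}) + Λ |Σ_k |E^k| - ω_n|`. -/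
def penEnergy (n : ℕ) (s ε Λ : ℝ) (F : ℕ → Set (Rn n)) : ℝ≥0∞ :=
  genEnergy n s ε F +
    ENNReal.ofReal Λ * ennAbsDiff (∑' k : ℕ, volume (F k)) (volume (ball (0 : Rn n) 1))

/-- `E` is a minimizer of `min { P_s(E) + ε V_s(E) : E ⊆ ℝⁿ measurable, |E| = ω_n }`. -/
def IsEnergyMin (n : ℕ) (s ε : ℝ) (E : Set (Rn n)) : Prop :=
  MeasurableSet E ∧ volume E = volume (ball (0 : Rn n) 1) ∧
    ∀ F : Set (Rn n), MeasurableSet F → volume F = volume (ball (0 : Rn n) 1) →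
      energy n s ε E ≤ energy n s ε F

/-- The kernel `|z|^{-(n+s)}` of the fractional perimeter. -/
def perKernel (n : ℕ) (s : ℝ) (z : Rn n) : ℝ≥0∞ := ENNReal.ofReal (‖z‖ ^ (-((n : ℝ) + s)))

/-- The interaction `∫_A ∫_B |x-y|^{-(n+s)} dy dx` between two sets. -/
def interaction (n : ℕ) (s : ℝ) (A B : Set (Rn n)) : ℝ≥0∞ :=
  ∫⁻ x in A, ∫⁻ y in B, perKernel n s (x - y)

section

variable {n : ℕ} {s : ℝ}

lemma fracPer_eq_interaction (E : Set (Rn n)) : fracPer n s E = interaction n s E Eᶜ := rfl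

@[fun_prop]
lemma measurable_perKernel : Measurable (perKernel n s) := by
  unfold perKernel; fun_prop

lemma perKernel_sub_comm (x y : Rn n) : perKernel n s (x - y) = perKernel n s (y - x) := by
  simp [perKernel, norm_sub_rev x y]

lemma interaction_comm (A B : Set (Rn n)) : interaction n s A B = interaction n s B A := by
  unfold interaction
  rw [lintegral_lintegral_swap (by fun_prop)]
  simp_rw [perKernel_sub_comm]

lemma interaction_union_right {A B C : Set (Rn n)} (hC : MeasurableSet C) (h : Disjoint B C) :
    interaction n s A (B ∪ C) = interaction n s A B + interaction n s A C := by
  unfold interaction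
  simp_rw [lintegral_union hC h]
  exact lintegral_add_left (by fun_prop) _

lemma interaction_union_left {A B C : Set (Rn n)} (hB : MeasurableSet B) (h : Disjoint A B) :
    interaction n s (A ∪ B) C = interaction n s A C + interaction n s B C := by
  rw [interaction_comm, interaction_union_right hB h, interaction_comm C A, interaction_comm C B]

lemma fracPer_add_fracPer {A D : Set (Rn n)} (hA : MeasurableSet A) (hD : MeasurableSet D)
    (h : Disjoint A D) :
    fracPer n s A + fracPer n s D = fracPer n s (A ∪ D) + 2 * interaction n s A D := by
  have hAc : Aᶜ = (A ∪ D)ᶜ ∪ D := by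
    ext x; have : x ∈ A → x ∉ D := fun hx => Set.disjoint_left.1 h hx
    simp; tauto
  have hDc : Dᶜ = (A ∪ D)ᶜ ∪ A := by
    ext x; have : x ∈ A → x ∉ D := fun hx => Set.disjoint_left.1 h hx
    simp; tauto
  have e1 : fracPer n s A = interaction n s A (A ∪ D)ᶜ + interaction n s A D := by
    rw [fracPer_eq_interaction, hAc, interaction_union_right hD]
    exact (disjoint_compl_left).mono_right subset_union_right
  have e2 : fracPer n s D = interaction n s D (A ∪ D)ᶜ + interaction n s A D := by
    rw [fracPer_eq_interaction, hDc, interaction_union_right hA, interaction_comm D A]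
    exact (disjoint_compl_left).mono_right subset_union_left
  rw [e1, e2, fracPer_eq_interaction, interaction_union_left hD h]
  ring

/-- Change of variables under a homothety composed with a translation. -/
lemma setLIntegral_preimage_homothety {E : Set (Rn n)} (hE : MeasurableSet E) {t : ℝ} (ht : 0 < t)
    (a : Rn n) (g : Rn n → ℝ≥0∞) (hg : Measurable g) :
    ∫⁻ x in (fun x => t • x + a) ⁻¹' E, g (t • x + a) =
      ENNReal.ofReal (t ^ (-(n : ℝ))) * ∫⁻ z in E, g z := by
  have hm : Measure.map (fun x : Rn n => t • x + a) volume =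
      ENNReal.ofReal (t ^ (-(n : ℝ))) • volume := by
    have h1 : (fun x : Rn n => t • x + a) = (fun x => x + a) ∘ (fun x => t • x) := rfl
    rw [h1, ← Measure.map_map (by fun_prop) (by fun_prop),
      Measure.map_addHaar_smul _ ht.ne', Measure.map_smul, map_add_right_eq_self]
    congr 2
    rw [finrank_euclideanSpace_fin, Real.rpow_neg ht.le, Real.rpow_natCast, abs_of_nonneg]
    positivity
  rw [← setLIntegral_map hE hg (by fun_prop), hm, Measure.restrict_smul, lintegral_smul_measure,
    smul_eq_mul]

lemma perKernel_smul {t : ℝ} (ht : 0 < t) (z : Rn n) :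
    perKernel n s z = ENNReal.ofReal (t ^ ((n : ℝ) + s)) * perKernel n s (t • z) := by
  unfold perKernel
  rw [← ENNReal.ofReal_mul (by positivity), norm_smul, Real.norm_of_nonneg ht.le,
    Real.mul_rpow ht.le (norm_nonneg _), ← mul_assoc, ← Real.rpow_add ht, add_neg_cancel,
    Real.rpow_zero, one_mul]

lemma volume_preimage_homothety {E : Set (Rn n)} (hE : MeasurableSet E) {t : ℝ} (ht : 0 < t)
    (a : Rn n) :
    volume ((fun x : Rn n => t • x + a) ⁻¹' E) = ENNReal.ofReal (t ^ (-(n : ℝ))) * volume E := by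
  simpa only [setLIntegral_one] using
    setLIntegral_preimage_homothety hE ht a (fun _ => 1) measurable_const

lemma fracPer_preimage_homothety {E : Set (Rn n)} (hE : MeasurableSet E) {t : ℝ} (ht : 0 < t)
    (a : Rn n) :
    fracPer n s ((fun x : Rn n => t • x + a) ⁻¹' E) =
      ENNReal.ofReal (t ^ (s - n)) * fracPer n s E := by
  have key (x y : Rn n) : perKernel n s (x - y) =
      ENNReal.ofReal (t ^ ((n : ℝ) + s)) * perKernel n s ((t • x + a) - (t • y + a)) := by
    rw [perKernel_smul ht]; congr 2; module
  rw [fracPer_eq_interaction, fracPer_eq_interaction, interaction, interaction, ← preimage_compl]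
  rw [lintegral_congr fun x => lintegral_congr fun y => key x y]
  have h1 (x : Rn n) : ∫⁻ y in (fun x : Rn n => t • x + a) ⁻¹' Eᶜ,
      ENNReal.ofReal (t ^ ((n : ℝ) + s)) * perKernel n s ((t • x + a) - (t • y + a)) =
      ENNReal.ofReal (t ^ s) * ∫⁻ y in Eᶜ, perKernel n s ((t • x + a) - y) := by
    rw [lintegral_const_mul _ (by fun_prop), setLIntegral_preimage_homothety hE.compl ht a
      (fun y => perKernel n s ((t • x + a) - y)) (by fun_prop), ← mul_assoc,
      ← ENNReal.ofReal_mul (by positivity), ← Real.rpow_add ht]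
    congr 3; ring
  simp_rw [h1]
  have hmeas : Measurable fun x : Rn n => ∫⁻ y in Eᶜ, perKernel n s (x - y) :=
    Measurable.lintegral_prod_right' (f := fun p : Rn n × Rn n => perKernel n s (p.1 - p.2))
      (by fun_prop)
  have hmeas' : Measurable fun x : Rn n => ∫⁻ y in Eᶜ, perKernel n s (t • x + a - y) :=
    hmeas.comp (g := fun x => ∫⁻ y in Eᶜ, perKernel n s (x - y))
      (f := fun x : Rn n => t • x + a) (by fun_prop)
  rw [lintegral_const_mul _ hmeas', setLIntegral_preimage_homothety hE ht a
    (fun x => ∫⁻ y in Eᶜ, perKernel n s (x - y)) hmeas, ← mul_assoc,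
    ← ENNReal.ofReal_mul (by positivity), ← Real.rpow_add ht]
  congr 3

lemma rieszAt_preimage_homothety {E : Set (Rn n)} (hE : MeasurableSet E) {t : ℝ} (ht : 0 < t)
    (a y : Rn n) :
    rieszAt n s ((fun x : Rn n => t • x + a) ⁻¹' E) y =
      ENNReal.ofReal (t ^ (s - n)) * rieszAt n s E (t • y + a) := by
  have key (x : Rn n) : ENNReal.ofReal (‖x - y‖ ^ (-s)) = ENNReal.ofReal (t ^ s) *
      ENNReal.ofReal (‖(t • x + a) - (t • y + a)‖ ^ (-s)) := by
    have : (t • x + a) - (t • y + a) = t • (x - y) := by module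
    rw [this, ← ENNReal.ofReal_mul (by positivity), norm_smul, Real.norm_of_nonneg ht.le,
      Real.mul_rpow ht.le (norm_nonneg _), ← mul_assoc, ← Real.rpow_add ht]
    simp
  unfold rieszAt
  simp_rw [key]
  rw [lintegral_const_mul _ (by fun_prop), setLIntegral_preimage_homothety hE ht a
    (fun x => ENNReal.ofReal (‖x - (t • y + a)‖ ^ (-s))) (by fun_prop), ← mul_assoc,
    ← ENNReal.ofReal_mul (by positivity), ← Real.rpow_add ht]
  congr 3

lemma Vs_preimage_homothety {E : Set (Rn n)} (hE : MeasurableSet E) {t : ℝ} (ht : 0 < t)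
    (a : Rn n) :
    Vs n s ((fun x : Rn n => t • x + a) ⁻¹' E) = ENNReal.ofReal (t ^ (s - n)) * Vs n s E := by
  unfold Vs
  simp_rw [rieszAt_preimage_homothety hE ht, ← ENNReal.mul_iSup]
  congr 1
  refine Function.Surjective.iSup_comp (f := fun y : Rn n => t • y + a) (fun z => ?_)
    (fun z => rieszAt n s E z)
  exact ⟨t⁻¹ • (z - a), by simp [smul_smul, ht.ne']⟩

lemma energy_preimage_homothety {E : Set (Rn n)} (hE : MeasurableSet E) {t : ℝ} (ht : 0 < t)
    (a : Rn n) (ε : ℝ) :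
    energy n s ε ((fun x : Rn n => t • x + a) ⁻¹' E) =
      ENNReal.ofReal (t ^ (s - n)) * energy n s ε E := by
  rw [energy, energy, fracPer_preimage_homothety hE ht, Vs_preimage_homothety hE ht]
  ring

lemma Vs_mono {A B : Set (Rn n)} (h : A ⊆ B) : Vs n s A ≤ Vs n s B :=
  iSup_mono fun _ => lintegral_mono_set h

lemma volume_ball_inter_mul_le (hs : 0 < (n : ℝ) + s) {B : Set (Rn n)} (hB : MeasurableSet B)
    {x : Rn n} (hx : x ∉ B) (r : ℝ) :
    volume (ball x r ∩ B) * ENNReal.ofReal (r ^ (-((n : ℝ) + s))) ≤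
      ∫⁻ y in B, perKernel n s (x - y) := by
  calc volume (ball x r ∩ B) * ENNReal.ofReal (r ^ (-((n : ℝ) + s)))
      = ∫⁻ y in ball x r ∩ B, ENNReal.ofReal (r ^ (-((n : ℝ) + s))) := by
        rw [setLIntegral_const, mul_comm]
    _ ≤ ∫⁻ y in ball x r ∩ B, perKernel n s (x - y) := by
        refine setLIntegral_mono' (measurableSet_ball.inter hB) fun y hy => ?_
        refine ENNReal.ofReal_le_ofReal ?_
        have hxy : 0 < ‖x - y‖ := by
          rw [norm_sub_pos_iff]; rintro rfl; exact hx hy.2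
        refine Real.rpow_le_rpow_of_nonpos hxy ?_ (by linarith)
        have := hy.1; rw [mem_ball, dist_comm, dist_eq_norm] at this; exact this.le
    _ ≤ _ := lintegral_mono_set inter_subset_right

/-- A lower bound for the perimeter of a set with a controlled density at scale `r`. -/
lemma le_fracPer_of_le_volume_ball_diff (hs : 0 < (n : ℝ) + s) {E : Set (Rn n)}
    {r : ℝ} {b : ℝ≥0∞} (h : ∀ x ∈ E, b ≤ volume (ball x r \ E)) (hE : MeasurableSet E) :
    volume E * (b * ENNReal.ofReal (r ^ (-((n : ℝ) + s)))) ≤ fracPer n s E := by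
  rw [fracPer_eq_interaction, interaction, mul_comm, ← setLIntegral_const]
  refine setLIntegral_mono' hE fun x hx => ?_
  refine le_trans ?_ (volume_ball_inter_mul_le hs hE.compl (fun h => h hx) r)
  gcongr
  exact h x hx

lemma exists_rescale (hn : 0 < n) {A : Set (Rn n)} (hA : MeasurableSet A) {t : ℝ} (ht : 0 < t)
    (hv : volume A = ENNReal.ofReal t * volume (ball (0 : Rn n) 1)) :
    ∃ F : Set (Rn n), MeasurableSet F ∧ volume F = volume (ball (0 : Rn n) 1) ∧
      fracPer n s A = ENNReal.ofReal (t ^ (1 - s / n)) * fracPer n s F ∧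
      Vs n s A = ENNReal.ofReal (t ^ (1 - s / n)) * Vs n s F := by
  have hn' : (0 : ℝ) < n := by exact_mod_cast hn
  have hr : 0 < t ^ (1 / (n : ℝ)) := by positivity
  have h1 : ENNReal.ofReal (t ^ (1 - s / n)) *
      ENNReal.ofReal ((t ^ (1 / (n : ℝ))) ^ (s - n)) = 1 := by
    rw [← Real.rpow_mul ht.le, ← ENNReal.ofReal_mul (by positivity), ← Real.rpow_add ht]
    have : 1 - s / n + 1 / n * (s - n) = 0 := by field_simp; ring
    rw [this]; simp
  refine ⟨(fun x : Rn n => t ^ (1 / (n : ℝ)) • x + 0) ⁻¹' A, ?_, ?_, ?_, ?_⟩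
  · exact hA.preimage (by fun_prop)
  · rw [volume_preimage_homothety hA hr, hv, ← mul_assoc, ← ENNReal.ofReal_mul (by positivity),
      ← Real.rpow_mul ht.le, mul_neg, one_div_mul_cancel hn'.ne', Real.rpow_neg_one,
      inv_mul_cancel₀ ht.ne']
    simp
  · rw [fracPer_preimage_homothety hA hr, ← mul_assoc, h1, one_mul]
  · rw [Vs_preimage_homothety hA hr, ← mul_assoc, h1, one_mul]

lemma one_add_le_rpow_add_rpow {a t : ℝ} (ha : 0 < a) (ha1 : a < 1) (ht : 1 / 2 ≤ t) (ht1 : t < 1) :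
    1 + (1 - t) ^ (1 - a) * ((1 - (1 / 2) ^ a) / 2) ≤
      t ^ (1 - a) + (1 - t) ^ (1 - a) * (1 - (1 - (1 / 2) ^ a) / 2) := by
  have h1 : t ≤ t ^ (1 - a) := by
    simpa using Real.rpow_le_rpow_of_exponent_ge (by linarith) ht1.le (by linarith : 1 - a ≤ 1)
  have h2 : (1 - t) ^ a ≤ (1 / 2) ^ a :=
    Real.rpow_le_rpow (by linarith) (by linarith) ha.le
  have h3 : (1 - t) ^ (1 - a) * (1 - t) ^ a = 1 - t := by
    rw [← Real.rpow_add (by linarith)]; simp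
  have h4 : 0 < (1 - t) ^ (1 - a) := Real.rpow_pos_of_pos (by linarith) _
  nlinarith [mul_le_mul_of_nonneg_left h2 h4.le]

/-- Splitting a competitor in two pieces costs a definite amount of energy. -/
lemma le_energy_split_aux (hn : 0 < n) (hs0 : 0 < s) (hs1 : s < n) {e ε t : ℝ} (he0 : 0 < e)
    (he : ∀ F : Set (Rn n), MeasurableSet F → volume F = volume (ball (0 : Rn n) 1) →
      ENNReal.ofReal e ≤ energy n s ε F)
    (hV : ∀ F : Set (Rn n), MeasurableSet F → volume F = volume (ball (0 : Rn n) 1) →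
      ENNReal.ofReal ε * Vs n s F ≤ ENNReal.ofReal ((1 - (1 / 2) ^ (s / n)) / 2 * e))
    {A D : Set (Rn n)} (hA : MeasurableSet A) (hD : MeasurableSet D)
    (ht : 1 / 2 ≤ t) (ht1 : t < 1)
    (hvA : volume A = ENNReal.ofReal t * volume (ball (0 : Rn n) 1))
    (hvD : volume D = ENNReal.ofReal (1 - t) * volume (ball (0 : Rn n) 1)) :
    ENNReal.ofReal (e * (1 + (1 - t) ^ (1 - s / n) * ((1 - (1 / 2) ^ (s / n)) / 2))) ≤
      fracPer n s A + fracPer n s D + ENNReal.ofReal ε * Vs n s A := by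
  have hn' : (0 : ℝ) < n := by exact_mod_cast hn
  obtain ⟨F, hF, hvF, hPF, hVF⟩ := exists_rescale (s := s) hn hA (by linarith) hvA
  obtain ⟨G, hG, hvG, hPG, -⟩ := exists_rescale (s := s) hn hD (by linarith) hvD
  set κ : ℝ := (1 - (1 / 2) ^ (s / n)) / 2
  have hκ : κ ≤ 1 := by
    have : (0 : ℝ) < (1 / 2) ^ (s / n) := by positivity
    simp only [κ]; linarith
  have h1 : ENNReal.ofReal (t ^ (1 - s / n) * e) ≤ fracPer n s A + ENNReal.ofReal ε * Vs n s A := by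
    rw [ENNReal.ofReal_mul (by positivity), hPF, hVF, mul_left_comm, ← mul_add]
    gcongr; exact he F hF hvF
  have h2 : ENNReal.ofReal ((1 - t) ^ (1 - s / n) * (e - κ * e)) ≤ fracPer n s D := by
    have : (0 : ℝ) ≤ (1 - t) ^ (1 - s / n) := Real.rpow_nonneg (by linarith) _
    rw [ENNReal.ofReal_mul this, hPG]
    gcongr
    have hκ0 : 0 ≤ κ * e := by
      have : (1 / 2 : ℝ) ^ (s / n) ≤ 1 := Real.rpow_le_one (by norm_num) (by norm_num) (by positivity)
      have : 0 ≤ κ := by simp only [κ]; linarith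
      positivity
    rw [ENNReal.ofReal_sub _ hκ0, tsub_le_iff_right]
    exact (he G hG hvG).trans (by unfold energy; gcongr; exact hV G hG hvG)
  have h3 := one_add_le_rpow_add_rpow (div_pos hs0 hn') ((div_lt_one hn').2 hs1) ht ht1
  change 1 + (1 - t) ^ (1 - s / n) * κ ≤ t ^ (1 - s / n) + (1 - t) ^ (1 - s / n) * (1 - κ) at h3
  calc _ ≤ ENNReal.ofReal (t ^ (1 - s / n) * e + (1 - t) ^ (1 - s / n) * (e - κ * e)) := by
        apply ENNReal.ofReal_le_ofReal
        linarith [mul_le_mul_of_nonneg_left h3 he0.le]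
    _ ≤ _ := ENNReal.ofReal_add_le
    _ ≤ _ := add_le_add h1 h2
    _ = _ := by ring

lemma le_energy_split (hn : 0 < n) (hs0 : 0 < s) (hs1 : s < n) {e ε t τ : ℝ} (he0 : 0 < e)
    (he : ∀ F : Set (Rn n), MeasurableSet F → volume F = volume (ball (0 : Rn n) 1) →
      ENNReal.ofReal e ≤ energy n s ε F)
    (hV : ∀ F : Set (Rn n), MeasurableSet F → volume F = volume (ball (0 : Rn n) 1) →
      ENNReal.ofReal ε * Vs n s F ≤ ENNReal.ofReal ((1 - (1 / 2) ^ (s / n)) / 2 * e))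
    {A D : Set (Rn n)} (hA : MeasurableSet A) (hD : MeasurableSet D)
    (hτ : 0 < τ) (ht : τ ≤ t) (ht1 : t ≤ 1 - τ)
    (hvA : volume A = ENNReal.ofReal t * volume (ball (0 : Rn n) 1))
    (hvD : volume D = ENNReal.ofReal (1 - t) * volume (ball (0 : Rn n) 1)) :
    ENNReal.ofReal (e * (1 + τ ^ (1 - s / n) * ((1 - (1 / 2) ^ (s / n)) / 2))) ≤
      fracPer n s A + fracPer n s D + ENNReal.ofReal ε * Vs n s (A ∪ D) := by
  have hn' : (0 : ℝ) < n := by exact_mod_cast hn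
  have hκ : (0 : ℝ) ≤ (1 - (1 / 2) ^ (s / n)) / 2 := by
    have : (1 / 2 : ℝ) ^ (s / n) ≤ 1 := Real.rpow_le_one (by norm_num) (by norm_num) (by positivity)
    linarith
  have ha : 0 ≤ 1 - s / n := by rw [sub_nonneg]; exact (div_le_one hn').2 hs1.le
  rcases le_total (1 / 2) t with h | h
  · refine le_trans ?_ ((le_energy_split_aux hn hs0 hs1 he0 he hV hA hD h (by linarith) hvA hvD).trans
      (by gcongr; exact Vs_mono subset_union_left))
    have : τ ≤ 1 - t := by linarith
    gcongr
  · refine le_trans ?_ ((le_energy_split_aux hn hs0 hs1 he0 he hV hD hA (t := 1 - t) (by linarith)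
      (by linarith) hvD (by simpa using hvA)).trans
      (by rw [add_comm (fracPer n s D)]; gcongr; exact Vs_mono subset_union_right))
    rw [sub_sub_cancel]
    gcongr

lemma lintegral_ball_norm_rpow_lt_top (hn : 0 < n) (hs1 : s < n) :
    ∫⁻ x in ball (0 : Rn n) 1, ENNReal.ofReal (‖x‖ ^ (-s)) < ∞ := by
  have : Nonempty (Fin n) := ⟨⟨0, hn⟩⟩
  have h : Integrable (fun x : Rn n => (Ioo (0 : ℝ) 1).indicator (fun r => r ^ (-s)) ‖x‖) := by
    rw [integrable_fun_norm_addHaar volume]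
    have : (fun r : ℝ => r ^ (Module.finrank ℝ (Rn n) - 1) •
        (Ioo (0 : ℝ) 1).indicator (fun r => r ^ (-s)) r) =
        (Ioo (0 : ℝ) 1).indicator (fun r => r ^ (n - 1 - s)) := by
      ext r
      by_cases hr : r ∈ Ioo (0 : ℝ) 1
      · simp only [hr, indicator_of_mem, finrank_euclideanSpace_fin, smul_eq_mul]
        rw [← Real.rpow_natCast, ← Real.rpow_add hr.1, Nat.cast_sub (by omega)]
        congr 1; push_cast; ring
      · simp [hr]
    rw [this, integrableOn_indicator_iff measurableSet_Ioo,
      inter_eq_left.2 (fun r hr => hr.1)]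
    exact (intervalIntegral.integrableOn_Ioo_rpow_iff one_pos).2 (by linarith)
  refine lt_of_le_of_lt ?_ h.lintegral_lt_top
  rw [← lintegral_indicator measurableSet_ball]
  refine lintegral_mono_ae ?_
  have h0 : ∀ᵐ x : Rn n, x ≠ 0 := by simp [ae_iff]
  filter_upwards [h0] with x hx
  by_cases hx1 : x ∈ ball (0 : Rn n) 1
  · have : ‖x‖ ∈ Ioo (0 : ℝ) 1 := ⟨norm_pos_iff.2 hx, by simpa using hx1⟩
    simp [hx1, this]
  · simp [hx1]

lemma Vs_le (hs0 : 0 < s) (E : Set (Rn n)) :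
    Vs n s E ≤ (∫⁻ x in ball (0 : Rn n) 1, ENNReal.ofReal (‖x‖ ^ (-s))) + volume E := by
  refine iSup_le fun y => ?_
  unfold rieszAt
  have hsub : E ⊆ ball y 1 ∪ E \ ball y 1 := fun x hx => by by_cases h : x ∈ ball y 1 <;> simp_all
  refine (lintegral_mono_set hsub).trans ((lintegral_union_le _ _ _).trans ?_)
  refine add_le_add ?_ ?_
  · have := ((measurePreserving_add_right (volume : Measure (Rn n)) y).setLIntegral_comp_preimage
      (measurableSet_ball (x := y) (ε := 1))
      (f := fun x => ENNReal.ofReal (‖x - y‖ ^ (-s))) (by fun_prop))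
    rw [← this]
    simp
  · calc ∫⁻ x in E \ ball y 1, ENNReal.ofReal (‖x - y‖ ^ (-s))
        ≤ ∫⁻ x in E \ ball y 1, 1 := by
          refine setLIntegral_mono measurable_const fun x hx => ?_
          rw [ENNReal.ofReal_le_one]
          have : 1 ≤ ‖x - y‖ := by simpa [dist_eq_norm] using hx.2
          exact Real.rpow_le_one_of_one_le_of_nonpos this (by linarith)
      _ ≤ volume E := by rw [setLIntegral_one]; exact measure_mono sdiff_subset

/-- The truncated kernel mass `∫ |z|^{-(n+s)} min(|z|/R, 1) dz`. -/
def truncMass (n : ℕ) (s R : ℝ) : ℝ≥0∞ :=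
  ∫⁻ z : Rn n, perKernel n s z * ENNReal.ofReal (min (‖z‖ / R) 1)

lemma truncMass_one_lt_top (hn : 0 < n) (hs0 : 0 < s) (hs1 : s < 1) : truncMass n s 1 < ∞ := by
  have : Nonempty (Fin n) := ⟨⟨0, hn⟩⟩
  have h : Integrable (fun x : Rn n => (fun r : ℝ => r ^ (-((n : ℝ) + s)) * min r 1) ‖x‖) := by
    rw [integrable_fun_norm_addHaar volume (f := fun r : ℝ => r ^ (-((n : ℝ) + s)) * min r 1),
      ← Ioo_union_Ici_eq_Ioi one_pos, integrableOn_union]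
    have key (r : ℝ) (hr : 0 < r) : r ^ (Module.finrank ℝ (Rn n) - 1) •
        (r ^ (-((n : ℝ) + s)) * min r 1) = r ^ (-1 - s) * min r 1 := by
      simp only [finrank_euclideanSpace_fin, smul_eq_mul]
      rw [← mul_assoc, ← Real.rpow_natCast, ← Real.rpow_add hr, Nat.cast_sub (by omega)]
      congr 2; push_cast; ring
    constructor
    · refine ((intervalIntegral.integrableOn_Ioo_rpow_iff (s := -s) one_pos).2
        (by linarith)).congr_fun (fun r hr => ?_) measurableSet_Ioo
      simp only
      rw [key r hr.1, min_eq_left hr.2.le, ← Real.rpow_add_one hr.1.ne']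
      congr 1; ring
    · refine IntegrableOn.congr_fun (f := fun r : ℝ => r ^ (-1 - s)) ?_ (fun r hr => ?_)
        measurableSet_Ici
      · rw [integrableOn_Ici_iff_integrableOn_Ioi]
        exact integrableOn_Ioi_rpow_of_lt (by linarith) one_pos
      · have hr' : (1 : ℝ) ≤ r := hr
        simp only
        rw [key r (by linarith), min_eq_right hr', mul_one]
  refine lt_of_le_of_lt (lintegral_mono fun z => ?_) h.lintegral_lt_top
  rw [perKernel, ← ENNReal.ofReal_mul (by positivity), div_one]

lemma tendsto_truncMass (hn : 0 < n) (hs0 : 0 < s) (hs1 : s < 1) :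
    Tendsto (truncMass n s) atTop (𝓝 0) := by
  have h0 : (0 : ℝ≥0∞) = ∫⁻ _ : Rn n, 0 := by simp
  rw [h0]
  refine tendsto_lintegral_filter_of_dominated_convergence
    (fun z : Rn n => perKernel n s z * ENNReal.ofReal (min (‖z‖ / 1) 1)) ?_ ?_
    (truncMass_one_lt_top hn hs0 hs1).ne ?_
  · exact Eventually.of_forall fun R => by fun_prop
  · filter_upwards [eventually_ge_atTop 1] with R hR
    refine Eventually.of_forall fun z => ?_
    gcongr
  · refine Eventually.of_forall fun z => ?_
    have h1 : Tendsto (fun R : ℝ => min (‖z‖ / R) 1) atTop (𝓝 (min 0 1)) :=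
      (tendsto_const_nhds.div_atTop tendsto_id).min tendsto_const_nhds
    have h2 := ENNReal.Tendsto.const_mul (a := perKernel n s z)
      ((ENNReal.continuous_ofReal.tendsto _).comp h1) (Or.inr ENNReal.ofReal_ne_top)
    simpa using h2

/-- Some sphere of radius in `[R, 2 * R]` cuts a set with small interaction across it. -/
lemma exists_radius_interaction_le (E : Set (Rn n)) {R : ℝ} (hR : 0 < R) :
    ∃ r ∈ Icc R (2 * R), interaction n s (E ∩ ball 0 r) (E \ ball 0 r) ≤
      volume E * truncMass n s R := by
  let S : Set (ℝ × Rn n × Rn n) := {p | ‖p.2.1‖ < p.1 ∧ p.1 ≤ ‖p.2.2‖}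
  have hS : MeasurableSet S :=
    (measurableSet_lt (f := fun p : ℝ × Rn n × Rn n => ‖p.2.1‖) (g := fun p => p.1)
      (by fun_prop) (by fun_prop)).inter
      (measurableSet_le (f := fun p : ℝ × Rn n × Rn n => p.1) (g := fun p => ‖p.2.2‖)
        (by fun_prop) (by fun_prop))
  let g : ℝ × Rn n × Rn n → ℝ≥0∞ := S.indicator fun p => perKernel n s (p.2.1 - p.2.2)
  have hg : Measurable g := Measurable.indicator (by fun_prop) hS
  have hI (r : ℝ) : interaction n s (E ∩ ball 0 r) (E \ ball 0 r) =
      ∫⁻ x in E, ∫⁻ y in E, g (r, x, y) := by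
    unfold interaction
    rw [inter_comm, ← Measure.restrict_restrict measurableSet_ball,
      ← lintegral_indicator measurableSet_ball]
    refine lintegral_congr fun x => ?_
    rw [Set.sdiff_eq, inter_comm E, ← Measure.restrict_restrict measurableSet_ball.compl]
    by_cases hx : x ∈ ball (0 : Rn n) r
    · rw [indicator_of_mem hx, ← lintegral_indicator measurableSet_ball.compl]
      refine lintegral_congr fun y => ?_
      have hx' : ‖x‖ < r := by simpa using hx
      by_cases hy : r ≤ ‖y‖ <;> simp [g, S, indicator, hx', hy]
    · rw [indicator_of_notMem hx]
      have hx' : ¬ ‖x‖ < r := by simpa using hx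
      simp [g, S, hx']
  have hmeas1 : Measurable fun p : ℝ × Rn n => ∫⁻ y in E, g (p.1, p.2, y) :=
    Measurable.lintegral_prod_right' (f := fun q : (ℝ × Rn n) × Rn n => g (q.1.1, q.1.2, q.2))
      (hg.comp (by fun_prop))
  have hmeas2 : Measurable fun r : ℝ => ∫⁻ x in E, ∫⁻ y in E, g (r, x, y) :=
    Measurable.lintegral_prod_right' hmeas1
  have hvol : volume (Icc R (2 * R)) = ENNReal.ofReal R := by
    rw [Real.volume_Icc]; congr 1; ring
  have hvol0 : ENNReal.ofReal R ≠ 0 := by simpa using hR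
  obtain ⟨r, hr, hle⟩ := exists_le_setLAverage (μ := volume) (s := Icc R (2 * R))
    (f := fun r => ∫⁻ x in E, ∫⁻ y in E, g (r, x, y)) (by rw [hvol]; exact hvol0)
    (by rw [hvol]; exact ENNReal.ofReal_ne_top) hmeas2.aemeasurable
  refine ⟨r, hr, ?_⟩
  rw [hI]
  refine hle.trans ?_
  rw [setLAverage_eq, hvol]
  refine ENNReal.div_le_of_le_mul ?_
  have hin (x y : Rn n) : ∫⁻ r in Icc R (2 * R), g (r, x, y) ≤
      ENNReal.ofReal R * (perKernel n s (x - y) * ENNReal.ofReal (min (‖x - y‖ / R) 1)) := by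
    have : ∀ r, g (r, x, y) = (Ioc ‖x‖ ‖y‖).indicator (fun _ => perKernel n s (x - y)) r := by
      intro r; simp [g, S, indicator]
    simp_rw [this]
    rw [lintegral_indicator measurableSet_Ioc, setLIntegral_const, mul_left_comm,
      ← ENNReal.ofReal_mul hR.le, Measure.restrict_apply measurableSet_Ioc,
      mul_min_of_nonneg _ _ hR.le, mul_one, mul_div_cancel₀ _ hR.ne', ENNReal.ofReal_min]
    gcongr
    refine le_min ?_ ?_
    · refine (measure_mono inter_subset_left).trans ?_
      rw [Real.volume_Ioc]
      refine ENNReal.ofReal_le_ofReal ?_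
      rw [norm_sub_rev]; exact norm_sub_norm_le y x
    · exact (measure_mono inter_subset_right).trans hvol.le
  calc ∫⁻ r in Icc R (2 * R), ∫⁻ x in E, ∫⁻ y in E, g (r, x, y)
      = ∫⁻ x in E, ∫⁻ r in Icc R (2 * R), ∫⁻ y in E, g (r, x, y) :=
        lintegral_lintegral_swap hmeas1.aemeasurable
    _ = ∫⁻ x in E, ∫⁻ y in E, ∫⁻ r in Icc R (2 * R), g (r, x, y) := by
        refine lintegral_congr fun x => lintegral_lintegral_swap ?_
        exact (hg.comp (g := g) (f := fun p : ℝ × Rn n => (p.1, x, p.2))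
          (by fun_prop)).aemeasurable
    _ ≤ ∫⁻ x in E, ENNReal.ofReal R * truncMass n s R := by
        refine lintegral_mono fun x => ?_
        calc _ ≤ ∫⁻ y, ENNReal.ofReal R *
              (perKernel n s (x - y) * ENNReal.ofReal (min (‖x - y‖ / R) 1)) :=
              (lintegral_mono fun y => hin x y).trans (setLIntegral_le_lintegral _ _)
          _ = _ := by
              rw [lintegral_const_mul _ (by fun_prop), truncMass,
                lintegral_sub_left_eq_self (fun z : Rn n =>
                  perKernel n s z * ENNReal.ofReal (min (‖z‖ / R) 1)) x]
    _ = _ := by rw [setLIntegral_const]; ring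

lemma exists_finite_measure_le_volume (n : ℕ) :
    ∃ ν : Measure (Rn n), IsFiniteMeasure ν ∧ ν ≤ volume ∧ volume ≪ ν := by
  have h_int : Integrable (fun x : Rn n => (1 + ‖x‖) ^ (-((n : ℝ) + 1))) :=
    integrable_one_add_norm (by simp)
  refine ⟨volume.withDensity fun x => ENNReal.ofReal ((1 + ‖x‖) ^ (-((n : ℝ) + 1))),
    isFiniteMeasure_withDensity_ofReal h_int.2, ?_, ?_⟩
  · refine (withDensity_mono (g := 1) (Eventually.of_forall fun x => ?_)).trans_eq withDensity_one
    refine ENNReal.ofReal_le_one.2 (Real.rpow_le_one_of_one_le_of_nonpos ?_ ?_)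
    · linarith [norm_nonneg x]
    · linarith [(n.cast_nonneg : (0 : ℝ) ≤ n)]
  · refine withDensity_absolutelyContinuous' (by fun_prop) (Eventually.of_forall fun x => ?_)
    have : 0 < (1 + ‖x‖) ^ (-((n : ℝ) + 1)) := by positivity
    simpa using this

/-- Weak sequential compactness of sets with bounded volume, tested against balls. -/
lemma exists_subseq_tendsto_volume_inter_ball {E : ℕ → Set (Rn n)}
    (hE : ∀ k, MeasurableSet (E k)) {v : ℝ≥0∞} (hv : v ≠ ∞) (hvol : ∀ k, volume (E k) = v) :
    ∃ φ : ℕ → ℕ, StrictMono φ ∧ ∀ (x : Rn n) (δ : ℝ), ∃ l : ℝ,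
      Tendsto (fun k => volume.real (E (φ k) ∩ ball x δ)) atTop (𝓝 l) := by
  have hfin : ∀ k, volume (E k) ≠ ∞ := fun k => by rw [hvol]; exact hv
  let u : ℕ → Lp ℝ 2 (volume : Measure (Rn n)) := fun k => indicatorConstLp 2 (hE k) (hfin k) 1
  let U : ℕ → WeakDual ℝ (Lp ℝ 2 (volume : Measure (Rn n))) := fun k =>
    WeakDual.toStrongDual.symm (InnerProductSpace.toDual ℝ _ (u k))
  have hU : ∀ k, U k ∈ WeakDual.toStrongDual ⁻¹' closedBall
      (0 : StrongDual ℝ (Lp ℝ 2 (volume : Measure (Rn n)))) (v.toReal ^ (1 / 2 : ℝ)) := by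
    intro k
    simp [U, u, norm_indicatorConstLp, measureReal_def, hvol]
  have : Fact ((2 : ℝ≥0∞) ≠ ∞) := ⟨by simp⟩
  obtain ⟨G, -, φ, hφ, hlim⟩ := WeakDual.isSeqCompact_closedBall _ _ _ _ hU
  refine ⟨φ, hφ, fun x δ => ?_⟩
  let w : Lp ℝ 2 (volume : Measure (Rn n)) :=
    indicatorConstLp 2 (measurableSet_ball (x := x) (ε := δ)) measure_ball_lt_top.ne 1
  refine ⟨G w, ?_⟩
  have h1 := ((WeakDual.eval_continuous w).tendsto G).comp hlim
  refine h1.congr fun k => ?_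
  exact L2.real_inner_indicatorConstLp_one_indicatorConstLp_one (hE _) measurableSet_ball _ _

/-- The density of `E` in the ball of radius `δ` around `x`. -/
def ballDensity (E : Set (Rn n)) (δ : ℝ) (x : Rn n) : ℝ :=
  volume.real (E ∩ ball x δ) / volume.real (ball (0 : Rn n) δ)

lemma measurable_ballDensity {E : Set (Rn n)} (hE : MeasurableSet E) (δ : ℝ) :
    Measurable (ballDensity E δ) := by
  unfold ballDensity Measure.real
  have : MeasurableSet {p : Rn n × Rn n | p.2 ∈ E ∧ dist p.2 p.1 < δ} :=
    (hE.preimage measurable_snd).inter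
      (measurableSet_lt (f := fun p : Rn n × Rn n => dist p.2 p.1) (by fun_prop) (by fun_prop))
  exact (measurable_measure_prodMk_left this).ennreal_toReal.div_const _

lemma volume_real_ball_eq (x : Rn n) (δ : ℝ) :
    volume.real (ball x δ) = volume.real (ball (0 : Rn n) δ) := by
  simp [measureReal_def, Measure.addHaar_ball_center]

lemma ballDensity_nonneg (E : Set (Rn n)) (δ : ℝ) (x : Rn n) : 0 ≤ ballDensity E δ x := by
  unfold ballDensity; positivity

lemma ballDensity_le_one (E : Set (Rn n)) (δ : ℝ) (x : Rn n) : ballDensity E δ x ≤ 1 := by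
  unfold ballDensity
  refine div_le_one_of_le₀ ?_ (by positivity)
  rw [← volume_real_ball_eq x]
  exact measureReal_mono inter_subset_right

lemma ballDensity_compl {E : Set (Rn n)} (hE : MeasurableSet E) {δ : ℝ} (hδ : 0 < δ) (x : Rn n) :
    ballDensity Eᶜ δ x = 1 - ballDensity E δ x := by
  unfold ballDensity
  have h0 : 0 < volume.real (ball (0 : Rn n) δ) :=
    ENNReal.toReal_pos (measure_ball_pos _ _ hδ).ne' measure_ball_lt_top.ne
  have := measureReal_inter_add_sdiff (μ := volume) (s := ball x δ) hE
  rw [volume_real_ball_eq, inter_comm, Set.sdiff_eq, inter_comm _ Eᶜ] at this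
  rw [eq_sub_iff_add_eq, ← add_div, div_eq_one_iff_eq h0.ne', ← this, add_comm]

lemma enorm_ballDensity_le (hs : 0 < (n : ℝ) + s) {B : Set (Rn n)} (hB : MeasurableSet B)
    {x : Rn n} (hx : x ∉ B) {δ : ℝ} (hδ : 0 < δ) :
    ‖ballDensity B δ x‖ₑ ≤ ENNReal.ofReal (δ ^ ((n : ℝ) + s) / volume.real (ball (0 : Rn n) δ)) *
      ∫⁻ y in B, perKernel n s (x - y) := by
  have h0 : 0 < volume.real (ball (0 : Rn n) δ) :=
    ENNReal.toReal_pos (measure_ball_pos _ _ hδ).ne' measure_ball_lt_top.ne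
  rw [Real.enorm_of_nonneg (ballDensity_nonneg _ _ _)]
  calc ENNReal.ofReal (ballDensity B δ x)
      = ENNReal.ofReal (δ ^ ((n : ℝ) + s) / volume.real (ball (0 : Rn n) δ)) *
        (volume (ball x δ ∩ B) * ENNReal.ofReal (δ ^ (-((n : ℝ) + s)))) := by
        have hfin : volume (ball x δ ∩ B) ≠ ∞ :=
          (measure_mono inter_subset_left).trans_lt measure_ball_lt_top |>.ne
        rw [← ENNReal.ofReal_toReal hfin, ← ENNReal.ofReal_mul (by positivity),
          ← ENNReal.ofReal_mul (by positivity), ballDensity, inter_comm, measureReal_def,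
          Real.rpow_neg hδ.le]
        congr 1
        have : δ ^ ((n : ℝ) + s) ≠ 0 := by positivity
        field_simp
    _ ≤ _ := by gcongr; exact volume_ball_inter_mul_le hs hB hx δ

/-- Sets of finite fractional perimeter are quantitatively close to their averages. -/
lemma lintegral_indicator_sub_ballDensity_le (hs : 0 < (n : ℝ) + s) {E : Set (Rn n)}
    (hE : MeasurableSet E) {δ : ℝ} (hδ : 0 < δ) :
    ∫⁻ x, ‖E.indicator (fun _ => (1 : ℝ)) x - ballDensity E δ x‖ₑ ≤
      2 * (ENNReal.ofReal (δ ^ ((n : ℝ) + s) / volume.real (ball (0 : Rn n) δ)) *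
        fracPer n s E) := by
  rw [← lintegral_add_compl _ hE, two_mul]
  have hm (B : Set (Rn n)) : Measurable fun x : Rn n => ∫⁻ y in B, perKernel n s (x - y) :=
    Measurable.lintegral_prod_right' (f := fun p : Rn n × Rn n => perKernel n s (p.1 - p.2))
      (by fun_prop)
  refine add_le_add ?_ ?_
  · rw [fracPer_eq_interaction, interaction, ← lintegral_const_mul _ (hm _)]
    refine setLIntegral_mono' hE fun x hx => ?_
    rw [indicator_of_mem hx, ← ballDensity_compl hE hδ]
    exact enorm_ballDensity_le hs hE.compl (fun h => h hx) hδ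
  · rw [fracPer_eq_interaction, interaction_comm, interaction, ← lintegral_const_mul _ (hm _)]
    refine setLIntegral_mono' hE.compl fun x hx => ?_
    rw [indicator_of_notMem hx, zero_sub, enorm_neg]
    exact enorm_ballDensity_le hs hE hx hδ

lemma tendsto_rpow_div_volume_ball (hs0 : 0 < s) :
    Tendsto (fun δ : ℝ => δ ^ ((n : ℝ) + s) / volume.real (ball (0 : Rn n) δ)) (𝓝[>] 0)
      (𝓝 0) := by
  have h1 : Tendsto (fun δ : ℝ => δ ^ s / volume.real (ball (0 : Rn n) 1)) (𝓝[>] 0) (𝓝 0) := by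
    have : Tendsto (fun δ : ℝ => δ ^ s) (𝓝[>] 0) (𝓝 ((0 : ℝ) ^ s)) :=
      (Real.continuousAt_rpow_const _ _ (Or.inr hs0.le)).tendsto.mono_left nhdsWithin_le_nhds
    rw [Real.zero_rpow hs0.ne'] at this
    simpa using this.div_const (volume.real (ball (0 : Rn n) 1))
  refine h1.congr' ?_
  filter_upwards [self_mem_nhdsWithin] with δ hδ
  have hδ' : (0 : ℝ) < δ := hδ
  rw [measureReal_def, measureReal_def, Measure.addHaar_ball_of_pos _ _ hδ', ENNReal.toReal_mul,
    ENNReal.toReal_ofReal (by positivity), finrank_euclideanSpace_fin, Real.rpow_add hδ',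
    Real.rpow_natCast, mul_div_mul_left]
  positivity

/-- Sets with equal volume and equibounded fractional perimeter are precompact for almost
everywhere convergence. -/
lemma exists_subseq_ae_eventually_mem_iff (hs0 : 0 < s) {E : ℕ → Set (Rn n)}
    (hE : ∀ k, MeasurableSet (E k)) {v M : ℝ≥0∞} (hv : v ≠ ∞) (hvol : ∀ k, volume (E k) = v)
    (hM : M ≠ ∞) (hP : ∀ k, fracPer n s (E k) ≤ M) :
    ∃ φ : ℕ → ℕ, StrictMono φ ∧ ∃ F : Set (Rn n), MeasurableSet F ∧
      ∀ᵐ x, ∀ᶠ k in atTop, (x ∈ E (φ k) ↔ x ∈ F) := by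
  obtain ⟨ν, hνfin, hν, hν'⟩ := exists_finite_measure_le_volume n
  obtain ⟨φ, hφ, hlim⟩ := exists_subseq_tendsto_volume_inter_ball hE hv hvol
  choose l hl using hlim
  have hs : 0 < (n : ℝ) + s := by positivity
  let χ : ℕ → Rn n → ℝ := fun k => (E (φ k)).indicator fun _ => 1
  have hχm : ∀ k, Measurable (χ k) := fun k => measurable_const.indicator (hE _)
  have hχ : ∀ k, MemLp (χ k) 1 ν := fun k => memLp_indicator_const 1 (hE _) 1
    (Or.inr (measure_ne_top _ _))
  have key : ∀ η : ℝ≥0∞, 0 < η → ∃ f : Rn n → ℝ, Measurable f ∧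
      ∀ᶠ k in atTop, ∫⁻ x, ‖χ k x - f x‖ₑ ∂ν < η := by
    intro η hη
    have h1 : Tendsto (fun δ : ℝ => 2 * (ENNReal.ofReal
        (δ ^ ((n : ℝ) + s) / volume.real (ball (0 : Rn n) δ)) * M)) (𝓝[>] 0) (𝓝 0) := by
      have h2 := (ENNReal.continuous_ofReal.tendsto 0).comp
        (tendsto_rpow_div_volume_ball (n := n) hs0)
      rw [ENNReal.ofReal_zero] at h2
      have h3 := ENNReal.Tendsto.const_mul (a := 2)
        (ENNReal.Tendsto.mul_const (b := M) h2 (Or.inr hM)) (Or.inr (by simp))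
      simpa using h3
    obtain ⟨δ, hδη, hδ⟩ := ((h1.eventually_lt_const (ENNReal.half_pos hη.ne')).and
      self_mem_nhdsWithin).exists
    have hδ' : (0 : ℝ) < δ := hδ
    have hlim : ∀ x, Tendsto (fun k => ballDensity (E (φ k)) δ x) atTop
        (𝓝 (l x δ / volume.real (ball (0 : Rn n) δ))) := fun x => (hl x δ).div_const _
    have hm := measurable_of_tendsto_metrizable
      (fun k => measurable_ballDensity (hE (φ k)) δ) (tendsto_pi_nhds.2 hlim)
    refine ⟨_, hm, ?_⟩
    have h4 := tendsto_lintegral_norm_of_dominated_convergence (μ := ν) (bound := fun _ => 1)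
      (F := fun k => ballDensity (E (φ k)) δ)
      (fun k => (measurable_ballDensity (hE (φ k)) δ).aestronglyMeasurable)
      (integrable_const (1 : ℝ)).2
      (fun k => Eventually.of_forall fun x => by
        rw [Real.norm_of_nonneg (ballDensity_nonneg _ _ _)]; exact ballDensity_le_one _ _ _)
      (Eventually.of_forall hlim)
    filter_upwards [h4.eventually_lt_const (ENNReal.half_pos hη.ne')] with k hk
    simp_rw [ofReal_norm] at hk
    calc ∫⁻ x, ‖χ k x - l x δ / volume.real (ball (0 : Rn n) δ)‖ₑ ∂ν
        ≤ ∫⁻ x, (‖χ k x - ballDensity (E (φ k)) δ x‖ₑ +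
          ‖ballDensity (E (φ k)) δ x - l x δ / volume.real (ball (0 : Rn n) δ)‖ₑ) ∂ν := by
          refine lintegral_mono fun x => ?_
          simp_rw [← edist_eq_enorm_sub]
          exact edist_triangle _ _ _
      _ = ∫⁻ x, ‖χ k x - ballDensity (E (φ k)) δ x‖ₑ ∂ν + ∫⁻ x, ‖ballDensity (E (φ k)) δ x -
            l x δ / volume.real (ball (0 : Rn n) δ)‖ₑ ∂ν :=
          lintegral_add_left ((hχm k).sub (measurable_ballDensity (hE _) δ)).enorm _
      _ < η / 2 + η / 2 := by
          refine ENNReal.add_lt_add (lt_of_le_of_lt ?_ hδη) hk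
          refine (lintegral_mono' hν le_rfl).trans
            ((lintegral_indicator_sub_ballDensity_le hs (hE _) hδ').trans ?_)
          gcongr
          exact hP _
      _ = η := ENNReal.add_halves η
  have hcauchy : CauchySeq fun k => (hχ k).toLp (χ k) := by
    rw [EMetric.cauchySeq_iff]
    intro η hη
    obtain ⟨f, hf, hfη⟩ := key (η / 2) (ENNReal.half_pos hη.ne')
    obtain ⟨N, hN⟩ := eventually_atTop.1 hfη
    refine ⟨N, fun i hi j hj => ?_⟩
    rw [Lp.edist_toLp_toLp, eLpNorm_one_eq_lintegral_enorm]
    calc ∫⁻ x, ‖(χ i - χ j) x‖ₑ ∂ν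
        ≤ ∫⁻ x, (‖χ i x - f x‖ₑ + ‖χ j x - f x‖ₑ) ∂ν := by
          refine lintegral_mono fun x => ?_
          rw [Pi.sub_apply]
          simp_rw [← edist_eq_enorm_sub]
          exact edist_triangle_right _ _ _
      _ = ∫⁻ x, ‖χ i x - f x‖ₑ ∂ν + ∫⁻ x, ‖χ j x - f x‖ₑ ∂ν :=
          lintegral_add_left ((hχm i).sub hf).enorm _
      _ < η / 2 + η / 2 := ENNReal.add_lt_add (hN i hi) (hN j hj)
      _ = η := ENNReal.add_halves η
  obtain ⟨G, hG⟩ := cauchySeq_tendsto_of_complete hcauchy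
  obtain ⟨ψ, hψ, hae⟩ := (tendstoInMeasure_of_tendsto_Lp hG).exists_seq_tendsto_ae
  refine ⟨φ ∘ ψ, hφ.comp hψ, {x | 1 / 2 < G x}, ?_, ?_⟩
  · exact measurableSet_lt measurable_const (Lp.stronglyMeasurable G).measurable
  · refine hν'.ae_le ?_
    filter_upwards [hae, ae_all_iff.2 fun k => (hχ k).coeFn_toLp] with x hx hx'
    simp_rw [hx'] at hx
    have hx2 := Metric.tendsto_atTop.1 hx (1 / 2) (by norm_num)
    obtain ⟨N, hN⟩ := hx2
    have hval : ∀ k, χ k x = 0 ∧ x ∉ E (φ k) ∨ χ k x = 1 ∧ x ∈ E (φ k) := by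
      intro k
      by_cases h : x ∈ E (φ k) <;> simp [χ, h]
    filter_upwards [eventually_ge_atTop N] with k hk
    have h1 := hN k hk
    rw [Real.dist_eq, abs_lt] at h1
    rcases hval (ψ k) with h | h
    · rw [h.1] at h1
      simp only [Function.comp_apply, h.2, false_iff, not_lt]
      linarith
    · rw [h.1] at h1
      simp only [Function.comp_apply, h.2, true_iff]
      linarith

lemma setLIntegral_le_liminf {α : Type*} [MeasurableSpace α] {μ : Measure α} {g : α → ℝ≥0∞}
    (hg : Measurable g) {A : ℕ → Set α} {B : Set α} (hA : ∀ k, MeasurableSet (A k))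
    (hB : MeasurableSet B) (h : ∀ᵐ x ∂μ, ∀ᶠ k in atTop, (x ∈ A k ↔ x ∈ B)) :
    ∫⁻ x in B, g x ∂μ ≤ liminf (fun k => ∫⁻ x in A k, g x ∂μ) atTop := by
  simp_rw [← lintegral_indicator hB, ← lintegral_indicator (hA _)]
  refine le_trans (lintegral_mono_ae ?_) (lintegral_liminf_le fun k => hg.indicator (hA k))
  filter_upwards [h] with x hx
  refine (Tendsto.liminf_eq ?_).ge
  refine tendsto_const_nhds.congr' ?_
  filter_upwards [hx] with k hk
  by_cases hxB : x ∈ B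
  · simp [hxB, hk.2 hxB]
  · have hxA : x ∉ A k := fun h => hxB (hk.1 h)
    simp [hxB, hxA]

lemma fracPer_eq_setLIntegral_prod (E : Set (Rn n)) :
    fracPer n s E = ∫⁻ p in E ×ˢ Eᶜ, perKernel n s (p.1 - p.2) ∂(volume.prod volume) := by
  rw [setLIntegral_prod _ (by fun_prop)]
  rfl

lemma fracPer_le_liminf {E : ℕ → Set (Rn n)} {F : Set (Rn n)} (hE : ∀ k, MeasurableSet (E k))
    (hF : MeasurableSet F) (h : ∀ᵐ x, ∀ᶠ k in atTop, (x ∈ E k ↔ x ∈ F)) :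
    fracPer n s F ≤ liminf (fun k => fracPer n s (E k)) atTop := by
  simp_rw [fracPer_eq_setLIntegral_prod]
  refine setLIntegral_le_liminf (by fun_prop) (fun k => (hE k).prod (hE k).compl)
    (hF.prod hF.compl) ?_
  filter_upwards [Measure.quasiMeasurePreserving_fst.ae h,
    Measure.quasiMeasurePreserving_snd.ae h] with p h1 h2
  filter_upwards [h1, h2] with k h3 h4
  simp [h3, h4]

lemma Vs_le_liminf {E : ℕ → Set (Rn n)} {F : Set (Rn n)} (hE : ∀ k, MeasurableSet (E k))
    (hF : MeasurableSet F) (h : ∀ᵐ x, ∀ᶠ k in atTop, (x ∈ E k ↔ x ∈ F)) :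
    Vs n s F ≤ liminf (fun k => Vs n s (E k)) atTop :=
  iSup_le fun y => (setLIntegral_le_liminf (by fun_prop) hE hF h).trans
    (liminf_le_liminf (Eventually.of_forall fun k => le_iSup (rieszAt n s (E k)) y))

lemma energy_le_liminf {ε : ℝ} {E : ℕ → Set (Rn n)} {F : Set (Rn n)}
    (hE : ∀ k, MeasurableSet (E k)) (hF : MeasurableSet F)
    (h : ∀ᵐ x, ∀ᶠ k in atTop, (x ∈ E k ↔ x ∈ F)) :
    energy n s ε F ≤ liminf (fun k => energy n s ε (E k)) atTop := by
  refine (add_le_add (fracPer_le_liminf hE hF h)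
    (mul_le_mul_right (Vs_le_liminf hE hF h) _)).trans ?_
  rw [← ENNReal.liminf_const_mul_of_ne_top ENNReal.ofReal_ne_top]
  simp_rw [liminf_eq_iSup_iInf_of_nat]
  rw [ENNReal.iSup_add_iSup_of_monotone
    (fun i j hij => biInf_mono fun k hk => hij.trans hk)
    (fun i j hij => biInf_mono fun k hk => hij.trans hk)]
  exact iSup_mono fun N => le_iInf₂ fun k hk =>
    add_le_add (iInf₂_le k hk) (iInf₂_le k hk)

lemma tendsto_volume_inter_ball {E : ℕ → Set (Rn n)} {F : Set (Rn n)}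
    (hE : ∀ k, MeasurableSet (E k)) (hF : MeasurableSet F)
    (h : ∀ᵐ x, ∀ᶠ k in atTop, (x ∈ E k ↔ x ∈ F)) (r : ℝ) :
    Tendsto (fun k => volume (E k ∩ ball 0 r)) atTop (𝓝 (volume (F ∩ ball 0 r))) := by
  refine tendsto_measure_of_ae_tendsto_indicator (B := ball 0 r) _ (hF.inter measurableSet_ball)
    (fun k => (hE k).inter measurableSet_ball) measurableSet_ball measure_ball_lt_top.ne
    (Eventually.of_forall fun k => inter_subset_right) ?_
  filter_upwards [h] with x hx
  filter_upwards [hx] with k hk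
  simp [hk]

/-- Sets of bounded fractional perimeter cannot vanish. -/
lemma exists_volume_ball_le (hs0 : 0 < s) {v M : ℝ≥0∞} (hv0 : v ≠ 0) (hM : M ≠ ∞) :
    ∃ r > (0 : ℝ), ∀ E : Set (Rn n), MeasurableSet E → volume E = v → fracPer n s E ≤ M →
      ∃ y, volume (ball (0 : Rn n) r) / 2 ≤ volume (ball y r ∩ E) := by
  have hs : 0 < (n : ℝ) + s := by positivity
  have h1 := (ENNReal.continuous_ofReal.tendsto 0).comp
    (tendsto_rpow_div_volume_ball (n := n) hs0)
  have h2 := (ENNReal.Tendsto.const_mul (a := 2) h1 (Or.inr (by simp))).inv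
  rw [ENNReal.ofReal_zero, mul_zero, ENNReal.inv_zero] at h2
  obtain ⟨r, hr, hr0⟩ := ((h2.eventually_const_lt
    (ENNReal.div_lt_top hM hv0)).and self_mem_nhdsWithin).exists
  have hr0' : (0 : ℝ) < r := hr0
  have hvol : volume (ball (0 : Rn n) r) ≠ ∞ := measure_ball_lt_top.ne
  have hvol0 : 0 < volume.real (ball (0 : Rn n) r) := ENNReal.toReal_pos (measure_ball_pos _ _ hr0').ne' hvol
  refine ⟨r, hr0', fun E hE hEv hP => ?_⟩
  by_contra! hlt
  have h3 := le_fracPer_of_le_volume_ball_diff (n := n) (s := s) (E := E) (r := r)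
    (b := volume (ball (0 : Rn n) r) / 2) hs (fun x _ => ?_) hE
  · refine absurd (h3.trans hP) (not_le.2 ?_)
    rw [hEv]
    rw [ENNReal.div_lt_iff (Or.inl hv0) (Or.inr hM), mul_comm] at hr
    convert hr using 2
    have hpos : (0 : ℝ) < r ^ ((n : ℝ) + s) := by positivity
    rw [Function.comp_apply, Real.rpow_neg hr0'.le, ENNReal.ofReal_inv_of_pos hpos,
      ENNReal.ofReal_div_of_pos hvol0, ofReal_measureReal hvol, ENNReal.div_eq_inv_mul,
      ENNReal.mul_inv (Or.inl (by simp)) (Or.inl (by simp)), ENNReal.inv_div (Or.inl hvol)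
        (Or.inr (by simpa using hpos)), ENNReal.div_eq_inv_mul, mul_assoc, mul_comm (volume _)]
  · have h4 : volume (ball x r) ≤ volume (ball x r ∩ E) + volume (ball x r \ E) :=
      (measure_inter_add_sdiff _ hE).ge
    have h5 : volume (ball x r) = volume (ball (0 : Rn n) r) := Measure.addHaar_ball_center _ _ _
    rw [h5] at h4
    by_contra! h6
    refine absurd h4 (not_le.2 ?_)
    calc _ < volume (ball (0 : Rn n) r) / 2 + volume (ball (0 : Rn n) r) / 2 :=
          ENNReal.add_lt_add (hlt x) h6
      _ = _ := ENNReal.add_halves _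

lemma exists_pos_le_fracPer (hn : 0 < n) (hs0 : 0 < s) :
    ∃ p : ℝ, 0 < p ∧ ∀ E : Set (Rn n), MeasurableSet E → volume E = volume (ball (0 : Rn n) 1) →
      ENNReal.ofReal p ≤ fracPer n s E := by
  have hs : 0 < (n : ℝ) + s := by positivity
  set ω := volume (ball (0 : Rn n) 1) with hω
  have hω0 : ω ≠ 0 := (measure_ball_pos _ _ one_pos).ne'
  have hωt : ω ≠ ∞ := measure_ball_lt_top.ne
  have hr : ENNReal.ofReal ((2 : ℝ) ^ (-((n : ℝ) + s))) ≠ 0 := by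
    simp only [ne_eq, ENNReal.ofReal_eq_zero, not_le]
    positivity
  have hne : ω * (ω * ENNReal.ofReal (2 ^ (-((n : ℝ) + s)))) ≠ ∞ :=
    ENNReal.mul_ne_top hωt (ENNReal.mul_ne_top hωt ENNReal.ofReal_ne_top)
  refine ⟨(ω * (ω * ENNReal.ofReal (2 ^ (-((n : ℝ) + s))))).toReal,
    ENNReal.toReal_pos (mul_ne_zero hω0 (mul_ne_zero hω0 hr)) hne, fun E hE hEv => ?_⟩
  rw [ENNReal.ofReal_toReal hne]
  have h := le_fracPer_of_le_volume_ball_diff (n := n) (s := s) (E := E) (r := 2)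
    (b := ω) hs (fun x _ => ?_) hE
  · rwa [hEv] at h
  · have h1 : volume (ball x 2) = ENNReal.ofReal (2 ^ n) * ω := by
      rw [Measure.addHaar_ball_of_pos _ _ two_pos, finrank_euclideanSpace_fin]
    have h2 : (2 : ℝ) ≤ 2 ^ n := le_self_pow₀ (by norm_num) hn.ne'
    have h3 : ω + ω ≤ volume (ball x 2) := by
      rw [h1, ← two_mul]
      gcongr
      exact (ENNReal.ofReal_ofNat 2).ge.trans (ENNReal.ofReal_le_ofReal h2)
    calc ω = ω + ω - ω := (ENNReal.add_sub_cancel_right hωt).symm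
      _ ≤ volume (ball x 2) - volume E := by rw [hEv]; gcongr
      _ ≤ volume (ball x 2 \ E) := le_measure_sdiff

/-- A minimizing sequence cannot split into two pieces of positive volume. -/
lemma volume_eq_of_tendsto_energy (hn : 0 < n) (hs0 : 0 < s) (hs1 : s < 1) {e ε : ℝ} (he0 : 0 < e)
    (he : ∀ F : Set (Rn n), MeasurableSet F → volume F = volume (ball (0 : Rn n) 1) →
      ENNReal.ofReal e ≤ energy n s ε F)
    (hV : ∀ F : Set (Rn n), MeasurableSet F → volume F = volume (ball (0 : Rn n) 1) →
      ENNReal.ofReal ε * Vs n s F ≤ ENNReal.ofReal ((1 - (1 / 2) ^ (s / n)) / 2 * e))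
    {E : ℕ → Set (Rn n)} {F : Set (Rn n)} (hE : ∀ k, MeasurableSet (E k))
    (hEv : ∀ k, volume (E k) = volume (ball (0 : Rn n) 1)) (hF : MeasurableSet F)
    (hEF : ∀ᵐ x, ∀ᶠ k in atTop, (x ∈ E k ↔ x ∈ F)) (hF0 : volume F ≠ 0)
    (hlim : Tendsto (fun k => energy n s ε (E k)) atTop (𝓝 (ENNReal.ofReal e))) :
    volume F = volume (ball (0 : Rn n) 1) := by
  have hn' : (1 : ℝ) ≤ n := by exact_mod_cast hn
  set ω := volume (ball (0 : Rn n) 1) with hω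
  have hω0 : ω ≠ 0 := (measure_ball_pos _ _ one_pos).ne'
  have hωt : ω ≠ ∞ := measure_ball_lt_top.ne
  have hFω : volume F ≤ ω := by
    have := setLIntegral_le_liminf (g := fun _ => 1) measurable_const hE hF hEF
    simpa [hEv] using this
  by_contra hne
  have hFt : volume F ≠ ∞ := ne_top_of_le_ne_top hωt hFω
  have hw0 : 0 < ω.toReal := ENNReal.toReal_pos hω0 hωt
  have hm0 : 0 < (volume F).toReal := ENNReal.toReal_pos hF0 hFt
  have hmw : (volume F).toReal < ω.toReal :=
    (ENNReal.toReal_lt_toReal hFt hωt).2 (lt_of_le_of_ne hFω hne)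
  set m := (volume F).toReal with hm
  set w := ω.toReal with hw
  have hωw : ω = ENNReal.ofReal w := (ENNReal.ofReal_toReal hωt).symm
  obtain ⟨τ, hτ0, hτ1, hτ2⟩ : ∃ τ > 0, τ * w < m ∧ m < (1 - τ) * w := by
    refine ⟨min m (w - m) / (2 * w), by have := sub_pos.2 hmw; positivity, ?_, ?_⟩
    · have h1 : min m (w - m) / (2 * w) * w = min m (w - m) / 2 := by field_simp
      rw [h1]
      have := min_le_left m (w - m)
      linarith
    · have h1 : (1 - min m (w - m) / (2 * w)) * w = w - min m (w - m) / 2 := by field_simp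
      rw [h1]
      have := min_le_right m (w - m)
      linarith
  have hτw : ENNReal.ofReal (τ * w) < volume F := by
    rw [← ENNReal.ofReal_toReal hFt]
    exact (ENNReal.ofReal_lt_ofReal_iff hm0).2 hτ1
  have hτw' : volume F < ENNReal.ofReal ((1 - τ) * w) := by
    rw [← ENNReal.ofReal_toReal hFt]
    exact (ENNReal.ofReal_lt_ofReal_iff (hm0.trans hτ2)).2 hτ2
  set T := ENNReal.ofReal (e * (1 + τ ^ (1 - s / n) * ((1 - (1 / 2) ^ (s / n)) / 2))) with hT
  have heT : ENNReal.ofReal e < T := by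
    have h1 : (1 / 2 : ℝ) ^ (s / n) < 1 :=
      Real.rpow_lt_one (by norm_num) (by norm_num) (by positivity)
    have h2 : 0 < τ ^ (1 - s / n) * ((1 - (1 / 2) ^ (s / n)) / 2) :=
      mul_pos (by positivity) (by linarith)
    refine (ENNReal.ofReal_lt_ofReal_iff (by positivity)).2 ?_
    nlinarith
  have htail : Tendsto (fun R => ENNReal.ofReal e + 2 * (ω * truncMass n s R)) atTop
      (𝓝 (ENNReal.ofReal e)) := by
    have := (ENNReal.Tendsto.const_mul (a := ω) (tendsto_truncMass hn hs0 hs1) (Or.inr hωt))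
    have := (ENNReal.Tendsto.const_mul (a := 2) this (Or.inr (by simp))).const_add
      (ENNReal.ofReal e)
    simpa using this
  have hball : Tendsto (fun R : ℝ => volume (F ∩ ball 0 R)) atTop (𝓝 (volume F)) := by
    have := tendsto_measure_iUnion_atTop (μ := volume) (s := fun R : ℝ => F ∩ ball (0 : Rn n) R)
      fun a b hab => inter_subset_inter_right _ (ball_subset_ball hab)
    have hU : ⋃ R : ℝ, ball (0 : Rn n) R = univ :=
      eq_univ_of_forall fun x => mem_iUnion.2 ⟨‖x‖ + 1, by simp⟩
    rwa [← inter_iUnion, hU, inter_univ] at this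
  obtain ⟨R, hR1, hR2, hR0⟩ := ((htail.eventually_lt_const heT).and
    ((hball.eventually_const_lt hτw).and (eventually_gt_atTop 0))).exists
  have hlim' : Tendsto (fun k => energy n s ε (E k) + 2 * (ω * truncMass n s R)) atTop
      (𝓝 (ENNReal.ofReal e + 2 * (ω * truncMass n s R))) := hlim.add_const _
  obtain ⟨k, hk1, hk2, hk3⟩ := ((hlim'.eventually_lt_const hR1).and
    (((tendsto_volume_inter_ball hE hF hEF R).eventually_const_lt hR2).and
    ((tendsto_volume_inter_ball hE hF hEF (2 * R)).eventually_lt_const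
      ((measure_mono inter_subset_left).trans_lt hτw')))).exists
  obtain ⟨r, hr, h_int⟩ := exists_radius_interaction_le (s := s) (E k) hR0
  have hA : MeasurableSet (E k ∩ ball 0 r) := (hE k).inter measurableSet_ball
  have hD : MeasurableSet (E k \ ball 0 r) := (hE k).diff measurableSet_ball
  have hadd : volume (E k ∩ ball 0 r) + volume (E k \ ball 0 r) = ω := by
    rw [measure_inter_add_sdiff _ measurableSet_ball, hEv]
  have hA1 : ENNReal.ofReal (τ * w) ≤ volume (E k ∩ ball 0 r) :=
    hk2.le.trans (measure_mono (inter_subset_inter_right _ (ball_subset_ball hr.1)))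
  have hA2 : volume (E k ∩ ball 0 r) ≤ ENNReal.ofReal ((1 - τ) * w) :=
    (measure_mono (inter_subset_inter_right _ (ball_subset_ball hr.2))).trans hk3.le
  have hAt : volume (E k ∩ ball 0 r) ≠ ∞ := ne_top_of_le_ne_top ENNReal.ofReal_ne_top hA2
  set a := (volume (E k ∩ ball 0 r)).toReal with ha
  have haA : volume (E k ∩ ball 0 r) = ENNReal.ofReal a := (ENNReal.ofReal_toReal hAt).symm
  have ha1 : τ * w ≤ a := (ENNReal.ofReal_le_iff_le_toReal hAt).1 hA1
  have ha2 : a ≤ (1 - τ) * w :=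
    ENNReal.toReal_le_of_le_ofReal (hm0.trans hτ2).le hA2
  have haw : a ≤ w := ha2.trans (by nlinarith)
  have hDv : volume (E k \ ball 0 r) = ENNReal.ofReal (w - a) := by
    rw [ENNReal.ofReal_sub _ ENNReal.toReal_nonneg, ← haA, ← hωw, ← hadd,
      ENNReal.add_sub_cancel_left hAt]
  have hsplit := le_energy_split hn hs0 (hs1.trans_le hn') he0 he hV hA hD hτ0 (t := a / w)
    ((le_div_iff₀ hw0).2 ha1) ((div_le_iff₀ hw0).2 ha2)
    (by
      rw [← hω, hωw, haA, ← ENNReal.ofReal_mul (div_nonneg ENNReal.toReal_nonneg hw0.le),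
        div_mul_cancel₀ _ hw0.ne'])
    (by
      rw [← hω, hωw, hDv, ← ENNReal.ofReal_mul (sub_nonneg.2 ((div_le_one hw0).2 haw)), sub_mul,
        div_mul_cancel₀ _ hw0.ne', one_mul])
  refine absurd hk1 (not_lt.2 (hsplit.trans ?_))
  have hdisj : Disjoint (E k ∩ ball 0 r) (E k \ ball 0 r) := disjoint_sdiff_inter.symm
  rw [fracPer_add_fracPer hA hD hdisj, inter_union_sdiff, energy, add_right_comm, ← hEv k]
  gcongr

/-- If the minimal energy is finite and controls the Riesz term, a minimizer exists. -/
lemma exists_isEnergyMin (hn : 0 < n) (hs0 : 0 < s) (hs1 : s < 1) {e ε : ℝ} (he0 : 0 < e)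
    (hinf : sInf (energy n s ε '' {F | MeasurableSet F ∧ volume F = volume (ball (0 : Rn n) 1)}) =
      ENNReal.ofReal e)
    (hV : ∀ F : Set (Rn n), MeasurableSet F → volume F = volume (ball (0 : Rn n) 1) →
      ENNReal.ofReal ε * Vs n s F ≤ ENNReal.ofReal ((1 - (1 / 2) ^ (s / n)) / 2 * e)) :
    ∃ E : Set (Rn n), IsEnergyMin n s ε E := by
  have he : ∀ F : Set (Rn n), MeasurableSet F → volume F = volume (ball (0 : Rn n) 1) →
      ENNReal.ofReal e ≤ energy n s ε F := fun F hF hFv => hinf ▸ sInf_le ⟨F, ⟨hF, hFv⟩, rfl⟩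
  obtain ⟨u, hu, hulim, huS⟩ := exists_seq_tendsto_sInf
    (S := energy n s ε '' {F | MeasurableSet F ∧ volume F = volume (ball (0 : Rn n) 1)})
    ⟨_, ball 0 1, ⟨measurableSet_ball, rfl⟩, rfl⟩ (OrderBot.bddBelow _)
  rw [hinf] at hulim
  choose G hG hGu using huS
  obtain ⟨N, hN⟩ := (hulim.eventually_lt_const
    (ENNReal.lt_add_right ENNReal.ofReal_ne_top one_ne_zero)).exists
  have hM : ENNReal.ofReal e + 1 ≠ ∞ := by simp
  obtain ⟨r, hr0, hr⟩ := exists_volume_ball_le (n := n) hs0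
    (measure_ball_pos volume (0 : Rn n) one_pos).ne' hM
  have hGM : ∀ k, energy n s ε (G (k + N)) ≤ ENNReal.ofReal e + 1 := fun k => by
    rw [hGu]
    exact (hu (Nat.le_add_left N k)).trans hN.le
  choose y hy using fun k => hr (G (k + N)) (hG _).1 (hG _).2 (le_self_add.trans (hGM k))
  let E : ℕ → Set (Rn n) := fun k => (fun x : Rn n => (1 : ℝ) • x + y k) ⁻¹' G (k + N)
  have hE : ∀ k, MeasurableSet (E k) := fun k =>
    (by fun_prop : Measurable fun x : Rn n => (1 : ℝ) • x + y k) (hG _).1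
  have hEv : ∀ k, volume (E k) = volume (ball (0 : Rn n) 1) := fun k => by
    rw [volume_preimage_homothety (hG _).1 one_pos, (hG _).2]
    simp
  have hEe : ∀ k, energy n s ε (E k) = u (k + N) := fun k => by
    rw [energy_preimage_homothety (hG _).1 one_pos, hGu]
    simp
  have hEr : ∀ k, volume (ball (0 : Rn n) r) / 2 ≤ volume (E k ∩ ball 0 r) := fun k => by
    have h1 := volume_preimage_homothety (measurableSet_ball.inter (hG (k + N)).1 :
      MeasurableSet (ball (y k) r ∩ G (k + N))) one_pos (y k)
    have h2 : (fun x : Rn n => (1 : ℝ) • x + y k) ⁻¹' ball (y k) r = ball 0 r := by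
      ext x
      simp
    rw [preimage_inter, h2, inter_comm, Real.one_rpow, ENNReal.ofReal_one, one_mul] at h1
    exact (hy k).trans h1.ge
  obtain ⟨φ, hφ, F, hF, hφF⟩ := exists_subseq_ae_eventually_mem_iff hs0 hE
    measure_ball_lt_top.ne hEv hM fun k => by
      refine le_trans le_self_add (b := energy n s ε (E k)) ?_
      rw [hEe, ← hGu]
      exact hGM k
  have hlim : Tendsto (fun k => energy n s ε (E (φ k))) atTop (𝓝 (ENNReal.ofReal e)) := by
    simp_rw [hEe]
    exact hulim.comp ((tendsto_add_atTop_nat N).comp hφ.tendsto_atTop)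
  have hF0 : volume F ≠ 0 := by
    have h1 : volume (ball (0 : Rn n) r) / 2 ≤ volume (F ∩ ball 0 r) :=
      ge_of_tendsto' (tendsto_volume_inter_ball (fun k => hE (φ k)) hF hφF r) fun k => hEr (φ k)
    refine ((ENNReal.half_pos (measure_ball_pos _ _ hr0).ne').trans_le
      (h1.trans (measure_mono inter_subset_left))).ne'
  refine ⟨F, hF, volume_eq_of_tendsto_energy hn hs0 hs1 he0 he hV (fun k => hE (φ k))
    (fun k => hEv (φ k)) hF hφF hF0 hlim, fun G hG hGv => ?_⟩
  calc energy n s ε F ≤ liminf (fun k => energy n s ε (E (φ k))) atTop :=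
        energy_le_liminf (fun k => hE (φ k)) hF hφF
    _ = ENNReal.ofReal e := hlim.liminf_eq
    _ ≤ energy n s ε G := he G hG hGv

end

/-- **Existence of (classical) minimizers.** There exists `ε₀ = ε₀(n,s) > 0` such that for every
`ε ∈ (0,ε₀)` the problem `min { P_s(E) + ε V_s(E) : E ⊆ ℝⁿ measurable, |E| = ω_n }`
admits a solution. -/
theorem stmt_12 (n : ℕ) (hn : 2 ≤ n) (s : ℝ) (hs : s ∈ Set.Ioo (0 : ℝ) 1) :
    ∃ ε₀ : ℝ, 0 < ε₀ ∧ ∀ ε : ℝ, 0 < ε → ε < ε₀ →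
      ∃ E : Set (Rn n), IsEnergyMin n s ε E := by
  obtain ⟨hs0, hs1⟩ := hs
  have hn0 : 0 < n := by lia
  have hn' : (1 : ℝ) ≤ n := by exact_mod_cast hn0
  obtain ⟨p, hp, hpE⟩ := exists_pos_le_fracPer (s := s) hn0 hs0
  set κ : ℝ := (1 - (1 / 2) ^ (s / n)) / 2 with hκ
  have hκ0 : 0 < κ := by
    have h1 : (1 / 2 : ℝ) ^ (s / n) < 1 :=
      Real.rpow_lt_one (by norm_num) (by norm_num) (by positivity)
    linarith
  obtain ⟨C, hC0, hC⟩ : ∃ C : ℝ, 0 ≤ C ∧ ∀ F : Set (Rn n),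
      volume F = volume (ball (0 : Rn n) 1) → Vs n s F ≤ ENNReal.ofReal C := by
    have hfin : (∫⁻ x in ball (0 : Rn n) 1, ENNReal.ofReal (‖x‖ ^ (-s))) +
        volume (ball (0 : Rn n) 1) ≠ ∞ := ENNReal.add_ne_top.2
      ⟨(lintegral_ball_norm_rpow_lt_top hn0 (hs1.trans_le hn')).ne, measure_ball_lt_top.ne⟩
    refine ⟨((∫⁻ x in ball (0 : Rn n) 1, ENNReal.ofReal (‖x‖ ^ (-s))) +
      volume (ball (0 : Rn n) 1)).toReal, ENNReal.toReal_nonneg, fun F hF => ?_⟩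
    rw [ENNReal.ofReal_toReal hfin, ← hF]
    exact Vs_le hs0 F
  refine ⟨κ * p / (C + 1), by positivity, fun ε hε0 hε => ?_⟩
  set I := sInf (energy n s ε '' {F | MeasurableSet F ∧ volume F = volume (ball (0 : Rn n) 1)})
    with hI
  have hIle : ∀ F : Set (Rn n), MeasurableSet F → volume F = volume (ball (0 : Rn n) 1) →
      I ≤ energy n s ε F := fun F hF hFv => sInf_le ⟨F, ⟨hF, hFv⟩, rfl⟩
  have hpI : ENNReal.ofReal p ≤ I := by
    refine le_sInf ?_
    rintro _ ⟨F, ⟨hF, hFv⟩, rfl⟩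
    exact (hpE F hF hFv).trans le_self_add
  by_cases hIt : I = ∞
  · exact ⟨ball 0 1, measurableSet_ball, rfl, fun F hF hFv =>
      le_top.trans (hIt ▸ hIle F hF hFv)⟩
  have hpe : p ≤ I.toReal := (ENNReal.ofReal_le_iff_le_toReal hIt).1 hpI
  refine exists_isEnergyMin hn0 hs0 hs1 (hp.trans_le hpe) (ENNReal.ofReal_toReal hIt).symm
    fun F _ hFv => ?_
  calc ENNReal.ofReal ε * Vs n s F ≤ ENNReal.ofReal ε * ENNReal.ofReal C := by
        gcongr
        exact hC F hFv
    _ = ENNReal.ofReal (ε * C) := (ENNReal.ofReal_mul hε0.le).symm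
    _ ≤ ENNReal.ofReal (κ * I.toReal) := by
        refine ENNReal.ofReal_le_ofReal ?_
        rw [lt_div_iff₀ (by positivity)] at hε
        nlinarith
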